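/- Let α be a finite type, let F : Finset α → ℝ be a monotone submodular set function with F(∅) = 0, let k ≥ 1 be an integer, and let OPT = max over all S ⊆ α with |S| ≤ k of F(S), assumed nonnegative. Let (G_i) be a greedy sequence: G_0 = ∅ and G_{i+1} = insert x_i G_i where x_i maximizes F(insert x G_i) − F(G_i) over all x ∈ α. Then F(G_k) ≥ (1 − (1 − 1/k)^k) · OPT ≥ (1 − 1/e) · OPT. -/

import Mathlib

/-- A set function on finite subsets of `α` is submodular if marginal gains are
diminishing. -/
def Submodular {α : Type*} [DecidableEq α] (F : Finset α → ℝ) : Prop :=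
  ∀ S T : Finset α, S ⊆ T → ∀ x ∉ T, F (insert x T) - F T ≤ F (insert x S) - F S

/-- The gain from adding a set is at most the sum of the gains from adding its elements. -/
theorem Submodular.union_sub_le_sum {α : Type*} [DecidableEq α] {F : Finset α → ℝ}
    (hmono : Monotone F) (hsub : Submodular F) (A S : Finset α) :
    F (A ∪ S) - F A ≤ ∑ y ∈ S, (F (insert y A) - F A) := by
  induction S using Finset.induction_on with
  | empty => simp
  | insert y S hy ih =>
    rw [Finset.sum_insert hy, Finset.union_insert]
    by_cases h : y ∈ A ∪ S
    · have hA := hmono (Finset.subset_insert y A)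
      rw [Finset.insert_eq_of_mem h]
      linarith
    · have hA := hsub A (A ∪ S) Finset.subset_union_left y h
      linarith

/-- A greedy step closes at least a `1 / k` fraction of the gap to any set of at most `k`
elements. -/
theorem Submodular.sub_greedy_step_le {α : Type*} [DecidableEq α] {F : Finset α → ℝ}
    (hmono : Monotone F) (hsub : Submodular F) {k : ℕ} (hk : 1 ≤ k) {A S : Finset α}
    (hS : S.card ≤ k) {x : α}
    (hx : ∀ y, F (insert y A) - F A ≤ F (insert x A) - F A) :
    F S - F (insert x A) ≤ (1 - 1 / (k : ℝ)) * (F S - F A) := by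
  have hk0 : (0 : ℝ) < k := by exact_mod_cast hk
  have hgain : 0 ≤ F (insert x A) - F A := sub_nonneg.2 (hmono (Finset.subset_insert x A))
  have hgap : F S - F A ≤ k * (F (insert x A) - F A) := calc
    F S - F A ≤ F (A ∪ S) - F A := sub_le_sub_right (hmono Finset.subset_union_right) _
    _ ≤ ∑ y ∈ S, (F (insert y A) - F A) := hsub.union_sub_le_sum hmono A S
    _ ≤ S.card * (F (insert x A) - F A) := by
      simpa using Finset.sum_le_card_nsmul S _ _ fun y _ => hx y
    _ ≤ k * (F (insert x A) - F A) := by gcongr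
  have hdiv : (F S - F A) / k ≤ F (insert x A) - F A := (div_le_iff₀' hk0).2 hgap
  calc F S - F (insert x A) ≤ F S - F A - (F S - F A) / k := by linarith
    _ = (1 - 1 / (k : ℝ)) * (F S - F A) := by ring

/-- **(1 − 1/e) greedy approximation guarantee (Nemhauser–Wolsey–Fisher).**
For a monotone submodular `F` with `F ∅ = 0`, if `OPT ≥ 0` is the maximum of `F`
over sets of cardinality at most `k` and `(G i)` is a greedy sequence, then
`F (G k) ≥ (1 - (1 - 1/k)^k) · OPT ≥ (1 - 1/e) · OPT`. -/
theorem greedy_one_sub_inv_e (α : Type*) [Fintype α] [DecidableEq α]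
    (F : Finset α → ℝ) (hmono : Monotone F) (hsub : Submodular F) (hF0 : F ∅ = 0)
    (k : ℕ) (hk : 1 ≤ k) (OPT : ℝ) (hOPT_nonneg : 0 ≤ OPT)
    (hOPT_ub : ∀ S : Finset α, S.card ≤ k → F S ≤ OPT)
    (hOPT_mem : ∃ S : Finset α, S.card ≤ k ∧ F S = OPT)
    (G : ℕ → Finset α) (hG0 : G 0 = ∅)
    (hGstep : ∀ i, ∃ x, G (i + 1) = insert x (G i) ∧
      ∀ y, F (insert y (G i)) - F (G i) ≤ F (insert x (G i)) - F (G i)) :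
    (1 - (1 - 1 / (k : ℝ)) ^ k) * OPT ≤ F (G k) ∧
      (1 - 1 / Real.exp 1) * OPT ≤ (1 - (1 - 1 / (k : ℝ)) ^ k) * OPT := by
  have hk1 : (1 : ℝ) ≤ k := by exact_mod_cast hk
  have hratio : 0 ≤ 1 - 1 / (k : ℝ) := sub_nonneg.2 ((div_le_one (by positivity)).2 hk1)
  constructor
  · obtain ⟨S, hS, rfl⟩ := hOPT_mem
    have hgap : ∀ i, F S - F (G i) ≤ (1 - 1 / (k : ℝ)) ^ i * F S := by
      intro i
      induction i with
      | zero => simp [hG0, hF0]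
      | succ i ih =>
        obtain ⟨x, hx, hmax⟩ := hGstep i
        rw [hx, pow_succ', mul_assoc]
        exact (hsub.sub_greedy_step_le hmono hk hS hmax).trans
          (mul_le_mul_of_nonneg_left ih hratio)
    linarith [hgap k]
  · have hexp : (1 - 1 / (k : ℝ)) ^ k ≤ 1 / Real.exp 1 := by
      rw [one_div (Real.exp 1), ← Real.exp_neg]
      exact Real.one_sub_div_pow_le_exp_neg hk1
    gcongr
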